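/- arXiv:1107.5340 — 7 statements merged into one kernel-verified Lean document; each statement's English description precedes it below -/
import Mathlib

section
/- Hill's identity: For all indices i, j with 1 ≤ i < j ≤ m+1, the m×m matrices satisfy A_i · B_j = A_j · B_i. -/
open Matrix

noncomputable section

/-- Lower triangular Toeplitz m×m matrix: entry (i,j) equals `a (i-j)` (0-based),
i.e. `a_{i-j+1}` in the 1-based notation of the paper, for j ≤ i, and 0 otherwise. -/
def lowT (m : ℕ) (a : Fin (m + 1) → ℝ) : Matrix (Fin m) (Fin m) ℝ :=
  fun i j =>
    if h : (j : ℕ) ≤ (i : ℕ) then a ⟨(i : ℕ) - (j : ℕ), by have := i.2; omega⟩ else 0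

/-- Upper triangular Toeplitz m×m matrix: entry (i,j) equals `a (m + i - j)` (0-based),
i.e. `a_{m+1+i-j}` in the 1-based notation of the paper, for i ≤ j, and 0 otherwise. -/
def upT (m : ℕ) (a : Fin (m + 1) → ℝ) : Matrix (Fin m) (Fin m) ℝ :=
  fun i j =>
    if h : (i : ℕ) ≤ (j : ℕ) then a ⟨m + (i : ℕ) - (j : ℕ), by have := j.2; omega⟩ else 0

/-- The 2m×2m Sylvester matrix S = [[D_L, N_L],[D_U, N_U]]. -/
def sylv (m : ℕ) (d n : Fin (m + 1) → ℝ) : Matrix (Fin (m + m)) (Fin (m + m)) ℝ :=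
  (fromBlocks (lowT m d) (lowT m n) (upT m d) (upT m n)).submatrix
    finSumFinEquiv.symm finSumFinEquiv.symm

/-- The 2m×2m lower triangular matrix D = [[D_L, 0],[D_U, D_L]]. -/
def dMat (m : ℕ) (d : Fin (m + 1) → ℝ) : Matrix (Fin (m + m)) (Fin (m + m)) ℝ :=
  (fromBlocks (lowT m d) (0 : Matrix (Fin m) (Fin m) ℝ) (upT m d) (lowT m d)).submatrix
    finSumFinEquiv.symm finSumFinEquiv.symm

/-- The m×2m matrix formed by the last m rows of a 2m×2m matrix. -/
def lastRows (m : ℕ) (M : Matrix (Fin (m + m)) (Fin (m + m)) ℝ) :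
    Matrix (Fin m) (Fin (m + m)) ℝ :=
  fun i j => M ⟨m + (i : ℕ), by have := i.2; omega⟩ j

/-- The m×m submatrix of an m×2m matrix consisting of the m consecutive columns
starting from column i (0-based; column i+1 in the 1-based notation of the paper). -/
def subCols (m : ℕ) (M : Matrix (Fin m) (Fin (m + m)) ℝ) (i : Fin (m + 1)) :
    Matrix (Fin m) (Fin m) ℝ :=
  fun r c => M r ⟨(i : ℕ) + (c : ℕ), by have := i.2; have := c.2; omega⟩

/-- The kernel T = ( -D_U·D_L⁻¹ | I_m | -D_L·D_U⁻¹ ), an m×3m matrix. -/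
def kerT (m : ℕ) (d : Fin (m + 1) → ℝ) : Matrix (Fin m) (Fin (m + m + m)) ℝ :=
  (fromCols
      (fromCols (-(upT m d * (lowT m d)⁻¹)) (1 : Matrix (Fin m) (Fin m) ℝ))
      (-(lowT m d * (upT m d)⁻¹))).submatrix id
    (((Equiv.sumCongr finSumFinEquiv (Equiv.refl (Fin m))).trans finSumFinEquiv).symm)

/-- T_i : the m×2m submatrix of T consisting of the 2m consecutive columns
starting from column i (0-based). -/
def tSub (m : ℕ) (d : Fin (m + 1) → ℝ) (i : Fin (m + 1)) :
    Matrix (Fin m) (Fin (m + m)) ℝ :=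
  fun r c => kerT m d r ⟨(i : ℕ) + (c : ℕ), by have := i.2; have := c.2; omega⟩

/-- T_{i,j} : the m×m submatrix of T_i consisting of the m consecutive columns
starting from column j (0-based). -/
def tSub2 (m : ℕ) (d : Fin (m + 1) → ℝ) (i j : Fin (m + 1)) :
    Matrix (Fin m) (Fin m) ℝ :=
  fun r c =>
    kerT m d r ⟨(i : ℕ) + (j : ℕ) + (c : ℕ), by have := i.2; have := j.2; have := c.2; omega⟩

/-- The 2m×m block column matrix [D_L; D_U]. -/
def dlMat (m : ℕ) (d : Fin (m + 1) → ℝ) : Matrix (Fin (m + m)) (Fin m) ℝ :=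
  (fromRows (lowT m d) (upT m d)).submatrix finSumFinEquiv.symm id

/-- The 2m×m block column matrix [0; D_L]. -/
def drMat (m : ℕ) (d : Fin (m + 1) → ℝ) : Matrix (Fin (m + m)) (Fin m) ℝ :=
  (fromRows (0 : Matrix (Fin m) (Fin m) ℝ) (lowT m d)).submatrix finSumFinEquiv.symm id

/-- The 2m×m block column matrix [N_L; N_U]. -/
def nMat (m : ℕ) (n : Fin (m + 1) → ℝ) : Matrix (Fin (m + m)) (Fin m) ℝ :=
  (fromRows (lowT m n) (upT m n)).submatrix finSumFinEquiv.symm id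

/-- The 3m×2m block matrix [[X_L, 0],[X_U, X_L],[0, X_U]] built from the
lower/upper triangular Toeplitz matrices of a. -/
def kMat (m : ℕ) (a : Fin (m + 1) → ℝ) : Matrix (Fin (m + m + m)) (Fin (m + m)) ℝ :=
  (fromRows
      (fromRows (fromCols (lowT m a) (0 : Matrix (Fin m) (Fin m) ℝ))
        (fromCols (upT m a) (lowT m a)))
      (fromCols (0 : Matrix (Fin m) (Fin m) ℝ) (upT m a))).submatrix
    (((Equiv.sumCongr finSumFinEquiv (Equiv.refl (Fin m))).trans finSumFinEquiv).symm)
    finSumFinEquiv.symm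

/-- Index reversal i ↦ m - i on 0-based indices, corresponding to the 1-based
index map i ↦ m - i + 2 of the paper. -/
def revIdx (m : ℕ) (i : Fin (m + 1)) : Fin (m + 1) := ⟨m - (i : ℕ), by omega⟩

/-- Right multiplication by `nMat m a` convolves the columns with the coefficients `a`. -/
lemma mul_nMat_apply (m : ℕ) (a : Fin (m + 1) → ℝ) (Y : Matrix (Fin m) (Fin (m + m)) ℝ)
    (r c : Fin m) : (Y * nMat m a) r c = ∑ k : Fin (m + 1), a k * subCols m Y k r c := by
  have hentry : ∀ s : Fin (m + m), nMat m a s c =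
      if h : (c : ℕ) ≤ s ∧ (s : ℕ) - c < m + 1 then a ⟨(s : ℕ) - c, h.2⟩ else 0 := by
    intro s
    refine Fin.addCases (fun s => ?_) (fun s => ?_) s
    · have : (s : ℕ) - c < m + 1 := by omega
      simp [nMat, lowT, this]
    · have h1 : (c : ℕ) ≤ m + s := by omega
      have h2 : m + (s : ℕ) - c < m + 1 ↔ (s : ℕ) ≤ c := by omega
      simp [nMat, upT, h1, h2, -Fin.natAdd_eq_addNat]
  rw [Matrix.mul_apply]
  symm
  refine Finset.sum_of_injOn (fun k : Fin (m + 1) => (⟨(k : ℕ) + c, by omega⟩ : Fin (m + m)))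
    ?_ ?_ ?_ ?_
  · intro x _ y _ h
    simp only [Fin.mk.injEq] at h
    ext
    omega
  · simp
  · intro s _ hs
    rw [hentry, dif_neg, mul_zero]
    intro h
    refine hs ⟨⟨(s : ℕ) - c, h.2⟩, by simp, ?_⟩
    ext
    simp [h.1]
  · intro k _
    rw [hentry, dif_pos ⟨by simp, by simp; omega⟩]
    simp [subCols, mul_comm]

/-- The companion matrix of the polynomial with coefficients `d`, in the monomial basis. -/
def companionMat (m : ℕ) (d : Fin (m + 1) → ℝ) : Matrix (Fin m) (Fin m) ℝ :=
  fun r c => if (c : ℕ) + 1 < m then (if (r : ℕ) = c + 1 then 1 else 0)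
    else -(d r.castSucc / d (Fin.last m))

lemma subCols_succ (m : ℕ) (d : Fin (m + 1) → ℝ) (hd : d (Fin.last m) ≠ 0)
    (Y : Matrix (Fin m) (Fin (m + m)) ℝ) (hY : Y * nMat m d = 0) (i : Fin m) :
    subCols m Y i.succ = subCols m Y i.castSucc * companionMat m d := by
  ext r c
  rw [Matrix.mul_apply]
  by_cases hc : (c : ℕ) + 1 < m
  · rw [Finset.sum_eq_single (⟨c + 1, hc⟩ : Fin m)]
    · simp [companionMat, hc, subCols, add_comm, add_left_comm]
    · intro b _ hb
      have : (b : ℕ) ≠ c + 1 := fun h => hb (Fin.ext h)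
      simp [companionMat, hc, this]
    · simp
  · have h := mul_nMat_apply m d Y r i
    rw [hY, Fin.sum_univ_castSucc] at h
    have hlast : subCols m Y (Fin.last m) r i = subCols m Y i.succ r c := by
      simp only [subCols]
      congr 2
      simp only [Fin.val_last, Fin.val_succ]
      omega
    have hswap : ∀ k : Fin m, subCols m Y k.castSucc r i = subCols m Y i.castSucc r k := by
      intro k
      simp [subCols, add_comm]
    simp only [hlast, hswap, Matrix.zero_apply] at h
    have hsum : ∑ k : Fin m, subCols m Y i.castSucc r k * companionMat m d k c =
        -(∑ k : Fin m, d k.castSucc * subCols m Y i.castSucc r k) / d (Fin.last m) := by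
      rw [← Finset.sum_neg_distrib, Finset.sum_div]
      refine Finset.sum_congr rfl fun k _ => ?_
      simp only [companionMat, hc, if_false]
      ring
    rw [hsum, eq_div_iff hd]
    linarith

lemma subCols_eq_mul_pow (m : ℕ) (d : Fin (m + 1) → ℝ) (hd : d (Fin.last m) ≠ 0)
    (Y : Matrix (Fin m) (Fin (m + m)) ℝ) (hY : Y * nMat m d = 0) (i : Fin (m + 1)) :
    subCols m Y i = subCols m Y 0 * companionMat m d ^ (i : ℕ) := by
  induction i using Fin.induction with
  | zero => simp
  | succ i ih =>
    rw [subCols_succ m d hd Y hY, ih, Matrix.mul_assoc]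
    simp [pow_succ]

lemma lastRows_mul_nMat_of_left (m : ℕ) (d : Fin (m + 1) → ℝ)
    (P Q : Matrix (Fin m) (Fin m) ℝ) (X : Matrix (Fin (m + m)) (Fin (m + m)) ℝ)
    (hX : X * (fromBlocks (lowT m d) P (upT m d) Q).submatrix
      finSumFinEquiv.symm finSumFinEquiv.symm = 1) :
    lastRows m X * nMat m d = 0 := by
  ext r c
  have h := congrFun (congrFun hX (Fin.natAdd m r)) (Fin.castAdd m c)
  rw [Matrix.one_apply_ne (by simp [Fin.ext_iff]; omega)] at h
  rw [Matrix.zero_apply, ← h]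
  simp only [Matrix.mul_apply, Fin.sum_univ_add]
  have hrow : lastRows m X r = X (Fin.natAdd m r) := rfl
  simp [hrow, nMat, -Fin.natAdd_eq_addNat]

lemma lastRows_mul_nMat_of_right (m : ℕ) (n : Fin (m + 1) → ℝ)
    (P Q : Matrix (Fin m) (Fin m) ℝ) (X : Matrix (Fin (m + m)) (Fin (m + m)) ℝ)
    (hX : X * (fromBlocks P (lowT m n) Q (upT m n)).submatrix
      finSumFinEquiv.symm finSumFinEquiv.symm = 1) :
    lastRows m X * nMat m n = 1 := by
  ext r c
  have h := congrFun (congrFun hX (Fin.natAdd m r)) (Fin.natAdd m c)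
  have h1 : (1 : Matrix (Fin (m + m)) (Fin (m + m)) ℝ) (Fin.natAdd m r) (Fin.natAdd m c) =
      (1 : Matrix (Fin m) (Fin m) ℝ) r c := by
    simp [Matrix.one_apply]
  rw [← h1, ← h]
  simp only [Matrix.mul_apply, Fin.sum_univ_add]
  have hrow : lastRows m X r = X (Fin.natAdd m r) := rfl
  simp [hrow, nMat, -Fin.natAdd_eq_addNat]

/-- If `Y` annihilates the shifts of `d` and inverts the shifts of `n`, then its leading block
is the inverse of a polynomial in the companion matrix of `d`. -/
lemma commute_companionMat_subCols_zero (m : ℕ) (d n : Fin (m + 1) → ℝ)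
    (hd : d (Fin.last m) ≠ 0) (Y : Matrix (Fin m) (Fin (m + m)) ℝ)
    (hY : Y * nMat m d = 0) (hYn : Y * nMat m n = 1) :
    Commute (companionMat m d) (subCols m Y 0) := by
  set M := companionMat m d
  set p : Matrix (Fin m) (Fin m) ℝ := ∑ k : Fin (m + 1), n k • M ^ (k : ℕ)
  have hp : subCols m Y 0 * p = 1 := by
    rw [← hYn]
    ext r c
    rw [mul_nMat_apply, Finset.mul_sum, Matrix.sum_apply]
    refine Finset.sum_congr rfl fun k _ => ?_
    rw [subCols_eq_mul_pow m d hd Y hY k, Matrix.mul_smul, Matrix.smul_apply, smul_eq_mul]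
  have hp' : p * subCols m Y 0 = 1 := mul_eq_one_comm.mp hp
  have hMp : Commute M p :=
    Commute.sum_right _ _ _ fun k _ => ((Commute.refl M).pow_right _).smul_right _
  exact hMp.units_inv_right (u := ⟨p, subCols m Y 0, hp', hp⟩)

theorem hill_identity (m : ℕ) (hm : 1 ≤ m) (d n : Fin (m + 1) → ℝ) (hd : ∀ k, d k ≠ 0) (hn : ∀ k, n k ≠ 0)
    (hS : IsUnit (sylv m d n)) (hD : IsUnit (dMat m d)) :
    ∀ i j : Fin (m + 1), i < j →
      subCols m (lastRows m (dMat m d)⁻¹) i * subCols m (lastRows m (sylv m d n)⁻¹) j =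
        subCols m (lastRows m (dMat m d)⁻¹) j * subCols m (lastRows m (sylv m d n)⁻¹) i := by
  intro i j _
  have hDinv : (dMat m d)⁻¹ * dMat m d = 1 :=
    Matrix.nonsing_inv_mul _ ((Matrix.isUnit_iff_isUnit_det _).mp hD)
  have hSinv : (sylv m d n)⁻¹ * sylv m d n = 1 :=
    Matrix.nonsing_inv_mul _ ((Matrix.isUnit_iff_isUnit_det _).mp hS)
  have hA := lastRows_mul_nMat_of_left m d _ _ _ hDinv
  have hB := lastRows_mul_nMat_of_left m d _ _ _ hSinv
  have hBn := lastRows_mul_nMat_of_right m n _ _ _ hSinv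
  have hlast := hd (Fin.last m)
  have hcomm := commute_companionMat_subCols_zero m d n hlast _ hB hBn
  rw [subCols_eq_mul_pow m d hlast _ hA i, subCols_eq_mul_pow m d hlast _ hA j,
    subCols_eq_mul_pow m d hlast _ hB i, subCols_eq_mul_pow m d hlast _ hB j,
    ← (hcomm.pow_left i).eq, ← (hcomm.pow_left j).eq]
  simp only [Matrix.mul_assoc]
  rw [← Matrix.mul_assoc (companionMat m d ^ (i : ℕ)), ← pow_add,
    ← Matrix.mul_assoc (companionMat m d ^ (j : ℕ)), ← pow_add, add_comm (i : ℕ)]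
end
end

section
/- For every i with 1 ≤ i ≤ m+1, the matrices A_i and B_i are invertible, and for all i, j with 1 ≤ i, j ≤ m+1 one has A_i⁻¹ · A_j = B_i⁻¹ · B_j. -/
open Matrix

noncomputable section

/-- The last rows of `M⁻¹` annihilate the first columns of `M`. -/
theorem lastRows_inv_mul_left {m : ℕ} {M : Matrix (Fin (m + m)) (Fin (m + m)) ℝ} (hM : IsUnit M) :
    lastRows m M⁻¹ * M.submatrix id (Fin.castAdd m) = 0 := by
  have h : M⁻¹ * M = 1 := nonsing_inv_mul M ((isUnit_iff_isUnit_det M).mp hM)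
  ext i j
  have hij := congrFun (congrFun h (Fin.natAdd m i)) (Fin.castAdd m j)
  rw [one_apply_ne (by simp [Fin.ext_iff]; omega)] at hij
  exact hij

/-- The last rows of `M⁻¹` form a left inverse of the last columns of `M`. -/
theorem lastRows_inv_mul_right {m : ℕ} {M : Matrix (Fin (m + m)) (Fin (m + m)) ℝ} (hM : IsUnit M) :
    lastRows m M⁻¹ * M.submatrix id (Fin.natAdd m) = 1 := by
  have h : M⁻¹ * M = 1 := nonsing_inv_mul M ((isUnit_iff_isUnit_det M).mp hM)
  ext i j
  have hij := congrFun (congrFun h (Fin.natAdd m i)) (Fin.natAdd m j)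
  have hone : (1 : Matrix (Fin (m + m)) (Fin (m + m)) ℝ) (Fin.natAdd m i) (Fin.natAdd m j) =
      (1 : Matrix (Fin m) (Fin m) ℝ) i j := by
    simp [one_apply, Fin.ext_iff]
  exact hij.trans hone

/-- A matrix annihilating the first columns of `M` factors through the last rows of `M⁻¹`. -/
theorem eq_mul_lastRows_inv {m : ℕ} {M : Matrix (Fin (m + m)) (Fin (m + m)) ℝ} (hM : IsUnit M)
    {X : Matrix (Fin m) (Fin (m + m)) ℝ} (hX : X * M.submatrix id (Fin.castAdd m) = 0) :
    X = X * M.submatrix id (Fin.natAdd m) * lastRows m M⁻¹ := by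
  have h : M * M⁻¹ = 1 := mul_nonsing_inv M ((isUnit_iff_isUnit_det M).mp hM)
  have hX' : X = X * M * M⁻¹ := by rw [Matrix.mul_assoc, h, Matrix.mul_one]
  ext i j
  conv_lhs => rw [hX']
  rw [mul_apply, Fin.sum_univ_add]
  have hzero : ∀ k : Fin m, (X * M) i (Fin.castAdd m k) = 0 :=
    fun k => congrFun (congrFun hX i) k
  simp only [hzero, zero_mul, Finset.sum_const_zero, zero_add]
  rfl

/-- The last rows of the inverses of two invertible matrices with the same first columns
differ by an invertible left factor. -/
theorem exists_isUnit_lastRows_inv_eq_mul {m : ℕ} {M N : Matrix (Fin (m + m)) (Fin (m + m)) ℝ}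
    (hM : IsUnit M) (hN : IsUnit N)
    (h : M.submatrix id (Fin.castAdd m) = N.submatrix id (Fin.castAdd m)) :
    ∃ P : Matrix (Fin m) (Fin m) ℝ, IsUnit P ∧ lastRows m N⁻¹ = P * lastRows m M⁻¹ := by
  have hNM := eq_mul_lastRows_inv hM (h ▸ lastRows_inv_mul_left hN)
  have hMN := eq_mul_lastRows_inv hN (h ▸ lastRows_inv_mul_left hM)
  refine ⟨_, ?_, hNM⟩
  refine IsUnit.of_mul_eq_one (lastRows m M⁻¹ * N.submatrix id (Fin.natAdd m)) ?_
  rw [← Matrix.mul_assoc, ← hNM, lastRows_inv_mul_right hN]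

theorem subCols_mul {m : ℕ} (P : Matrix (Fin m) (Fin m) ℝ) (X : Matrix (Fin m) (Fin (m + m)) ℝ)
    (i : Fin (m + 1)) : subCols m (P * X) i = P * subCols m X i := rfl

/-- A row vector annihilated by a banded matrix whose two extreme diagonals have no zero entry
vanishes as soon as `m` consecutive entries of it vanish. -/
theorem eq_zero_of_vecMul_band_eq_zero {m : ℕ} {M : Matrix (Fin (m + m)) (Fin m) ℝ}
    (hband : ∀ (k : Fin (m + m)) (j : Fin m), (k : ℕ) < j ∨ (j : ℕ) + m < k → M k j = 0)
    (hlow : ∀ j, M (Fin.castAdd m j) j ≠ 0) (hhigh : ∀ j, M (Fin.natAdd m j) j ≠ 0)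
    {w : Fin (m + m) → ℝ} (hw : w ᵥ* M = 0) {i : ℕ} (hi : i ≤ m)
    (hwi : ∀ k : Fin (m + m), i ≤ (k : ℕ) → (k : ℕ) < i + m → w k = 0) : w = 0 := by
  have hsingle : ∀ (j : Fin m) (k : Fin (m + m)), M k j ≠ 0 →
      (∀ l : Fin (m + m), l ≠ k → (j : ℕ) ≤ l → (l : ℕ) ≤ j + m → w l = 0) → w k = 0 := by
    intro j k hk hl
    have hj : ∑ l, w l * M l j = 0 := congrFun hw j
    rw [Finset.sum_eq_single k] at hj
    · exact (mul_eq_zero.mp hj).resolve_right hk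
    · intro l _ hlk
      by_cases hjl : (l : ℕ) < j ∨ (j : ℕ) + m < l
      · rw [hband l j hjl, mul_zero]
      · rw [hl l hlk (by omega) (by omega), zero_mul]
    · simp
  have hforward : ∀ (a : ℕ) (k : Fin (m + m)), (k : ℕ) = a → i ≤ a → w k = 0 := by
    intro a
    induction a using Nat.strong_induction_on with
    | _ a ih =>
      intro k hka hia
      by_cases hlt : a < i + m
      · exact hwi k (by omega) (by omega)
      · have hk : k = Fin.natAdd m ⟨a - m, by omega⟩ := Fin.ext (by simp; omega)
        refine hsingle ⟨a - m, by omega⟩ k (hk ▸ hhigh _) fun l hlk hjl hlj => ?_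
        have hne : (l : ℕ) ≠ k := fun h => hlk (Fin.ext h)
        simp only at hjl hlj
        exact ih l (by omega) l rfl (by omega)
  have hbackward : ∀ (a : ℕ) (k : Fin (m + m)), (k : ℕ) + a = i → w k = 0 := by
    intro a
    induction a using Nat.strong_induction_on with
    | _ a ih =>
      intro k hka
      by_cases hia : i ≤ (k : ℕ)
      · exact hforward k k rfl hia
      · have hk : k = Fin.castAdd m ⟨k, by omega⟩ := Fin.ext (by simp)
        have hk' : M k ⟨k, by omega⟩ ≠ 0 := by
          have := hlow ⟨k, by omega⟩
          rwa [← hk] at this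
        refine hsingle ⟨k, by omega⟩ k hk' fun l hlk hjl hlj => ?_
        have hne : (l : ℕ) ≠ k := fun h => hlk (Fin.ext h)
        simp only at hjl hlj
        by_cases hil : i ≤ (l : ℕ)
        · exact hforward l l rfl hil
        · exact ih (i - l) (by omega) l (by omega)
  funext k
  by_cases hik : i ≤ (k : ℕ)
  · exact hforward k k rfl hik
  · exact hbackward (i - k) k (by omega)

theorem dlMat_eq_zero_of_lt_or_lt {m : ℕ} (d : Fin (m + 1) → ℝ) (k : Fin (m + m)) (j : Fin m)
    (h : (k : ℕ) < j ∨ (j : ℕ) + m < k) : dlMat m d k j = 0 := by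
  induction k using Fin.addCases with
  | left k =>
    simp only [Fin.val_castAdd] at h
    simp only [dlMat, submatrix_apply, finSumFinEquiv_symm_apply_castAdd, fromRows_apply_inl, id,
      lowT]
    exact dif_neg (by omega)
  | right k =>
    simp only [Fin.val_natAdd] at h
    simp only [dlMat, submatrix_apply, finSumFinEquiv_symm_apply_natAdd, fromRows_apply_inr, id,
      upT]
    exact dif_neg (by omega)

theorem dlMat_castAdd_self {m : ℕ} (d : Fin (m + 1) → ℝ) (j : Fin m) :
    dlMat m d (Fin.castAdd m j) j = d 0 := by
  simp [dlMat, lowT]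

theorem dlMat_natAdd_self {m : ℕ} (d : Fin (m + 1) → ℝ) (j : Fin m) :
    dlMat m d (Fin.natAdd m j) j = d (Fin.last m) := by
  simp [-Fin.natAdd_eq_addNat, dlMat, upT, Fin.last]

theorem dMat_submatrix_castAdd (m : ℕ) (d : Fin (m + 1) → ℝ) :
    (dMat m d).submatrix id (Fin.castAdd m) = dlMat m d := by
  ext k j
  induction k using Fin.addCases <;> simp [-Fin.natAdd_eq_addNat, dMat, dlMat]

theorem sylv_submatrix_castAdd (m : ℕ) (d n : Fin (m + 1) → ℝ) :
    (sylv m d n).submatrix id (Fin.castAdd m) = dlMat m d := by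
  ext k j
  induction k using Fin.addCases <;> simp [-Fin.natAdd_eq_addNat, sylv, dlMat]

/-- Any `m` consecutive columns of the last rows of the inverse of a matrix whose first columns
are `dlMat m d` form an invertible matrix. -/
theorem isUnit_subCols_lastRows_inv {m : ℕ} {d : Fin (m + 1) → ℝ} (hd : ∀ k, d k ≠ 0)
    {M : Matrix (Fin (m + m)) (Fin (m + m)) ℝ} (hM : IsUnit M)
    (hcols : M.submatrix id (Fin.castAdd m) = dlMat m d) (i : Fin (m + 1)) :
    IsUnit (subCols m (lastRows m M⁻¹) i) := by
  rw [← vecMul_injective_iff_isUnit]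
  refine (injective_iff_map_eq_zero (vecMulLinear (subCols m (lastRows m M⁻¹) i))).mpr
    fun v hv => ?_
  have hw : v ᵥ* lastRows m M⁻¹ = 0 := by
    refine eq_zero_of_vecMul_band_eq_zero (dlMat_eq_zero_of_lt_or_lt d)
      (fun j => dlMat_castAdd_self d j ▸ hd _) (fun j => dlMat_natAdd_self d j ▸ hd _)
      ?_ (Nat.le_of_lt_succ i.2) fun k hik hki => ?_
    · rw [vecMul_vecMul, ← hcols, lastRows_inv_mul_left hM, vecMul_zero]
    · have hc := congrFun hv ⟨(k : ℕ) - i, by omega⟩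
      have hk : k = ⟨(i : ℕ) + ((k : ℕ) - i), by omega⟩ := Fin.ext (by simp; omega)
      rw [hk]
      exact hc
  rw [← vecMul_one v, ← lastRows_inv_mul_right hM, ← vecMul_vecMul, hw, zero_vecMul]

theorem inv_mul_eq (m : ℕ) (hm : 1 ≤ m) (d n : Fin (m + 1) → ℝ) (hd : ∀ k, d k ≠ 0) (hn : ∀ k, n k ≠ 0)
    (hS : IsUnit (sylv m d n)) (hD : IsUnit (dMat m d)) :
    (∀ i : Fin (m + 1), IsUnit (subCols m (lastRows m (dMat m d)⁻¹) i) ∧ IsUnit (subCols m (lastRows m (sylv m d n)⁻¹) i)) ∧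
      ∀ i j : Fin (m + 1),
        (subCols m (lastRows m (dMat m d)⁻¹) i)⁻¹ * subCols m (lastRows m (dMat m d)⁻¹) j =
          (subCols m (lastRows m (sylv m d n)⁻¹) i)⁻¹ * subCols m (lastRows m (sylv m d n)⁻¹) j := by
  have hcols := (dMat_submatrix_castAdd m d).trans (sylv_submatrix_castAdd m d n).symm
  obtain ⟨P, hP, hPeq⟩ := exists_isUnit_lastRows_inv_eq_mul hD hS hcols
  refine ⟨fun i => ⟨isUnit_subCols_lastRows_inv hd hD (dMat_submatrix_castAdd m d) i,
    isUnit_subCols_lastRows_inv hd hS (sylv_submatrix_castAdd m d n) i⟩, fun i j => ?_⟩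
  rw [hPeq, subCols_mul, subCols_mul, Matrix.mul_inv_rev, Matrix.mul_assoc,
    nonsing_inv_mul_cancel_left _ _ ((isUnit_iff_isUnit_det P).mp hP)]
end
end

section
/- Let D_l be the 2m×m block column matrix D_l = [D_L; D_U]. Then for every i with 1 ≤ i ≤ m+1, T_i · D_l = 0 (the m×m zero matrix). -/
open Matrix

noncomputable section

/-- The entries `a (k - j)` of the infinite banded Toeplitz matrix with symbol `a`. -/
def bandEntry (m : ℕ) (a : Fin (m + 1) → ℝ) (k j : ℕ) : ℝ :=
  if h : j ≤ k ∧ k ≤ j + m then a ⟨k - j, by omega⟩ else 0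

theorem lowT_apply_eq_bandEntry (m : ℕ) (a : Fin (m + 1) → ℝ) (i j : Fin m) :
    lowT m a i j = bandEntry m a i j := by
  have hi := i.2
  unfold lowT bandEntry
  split_ifs with h₁ h₂ h₂
  · rfl
  · omega
  · omega
  · rfl

theorem upT_apply_eq_bandEntry (m : ℕ) (a : Fin (m + 1) → ℝ) (i j : Fin m) :
    upT m a i j = bandEntry m a (m + i) j := by
  have hj := j.2
  unfold upT bandEntry
  split_ifs with h₁ h₂ h₂
  · rfl
  · omega
  · omega
  · rfl

theorem bandEntry_add_add (m : ℕ) (a : Fin (m + 1) → ℝ) (s k j : ℕ) :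
    bandEntry m a (s + k) (s + j) = bandEntry m a k j := by
  unfold bandEntry
  simp only [add_assoc, add_le_add_iff_left, Nat.add_sub_add_left]

theorem bandEntry_eq_zero (m : ℕ) (a : Fin (m + 1) → ℝ) {k j : ℕ} (h : k < j ∨ j + m < k) :
    bandEntry m a k j = 0 :=
  dif_neg (by omega)

theorem dlMat_apply (m : ℕ) (a : Fin (m + 1) → ℝ) (c : Fin (m + m)) (j : Fin m) :
    dlMat m a c j = bandEntry m a c j := by
  induction c using Fin.addCases with
  | left c => simp [dlMat, lowT_apply_eq_bandEntry]
  | right c => simp [-Fin.natAdd_eq_addNat, dlMat, upT_apply_eq_bandEntry]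

theorem kMat_apply (m : ℕ) (a : Fin (m + 1) → ℝ) (k : Fin (m + m + m)) (j : Fin (m + m)) :
    kMat m a k j = bandEntry m a k j := by
  induction k using Fin.addCases with
  | left k =>
    induction k using Fin.addCases with
    | left k =>
      induction j using Fin.addCases with
      | left j => simp [kMat, lowT_apply_eq_bandEntry]
      | right j =>
        simp [-Fin.natAdd_eq_addNat, kMat,
          bandEntry_eq_zero m a (k := k) (j := m + j) (by omega)]
    | right k =>
      induction j using Fin.addCases with
      | left j => simp [-Fin.natAdd_eq_addNat, kMat, upT_apply_eq_bandEntry]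
      | right j => simp [-Fin.natAdd_eq_addNat, kMat, lowT_apply_eq_bandEntry, bandEntry_add_add]
  | right k =>
    induction j using Fin.addCases with
    | left j => simp [kMat, bandEntry_eq_zero m a (k := m + m + k) (j := j) (by omega)]
    | right j =>
      simp [-Fin.natAdd_eq_addNat, kMat, upT_apply_eq_bandEntry, add_assoc, bandEntry_add_add]

theorem isUnit_det_lowT (m : ℕ) (a : Fin (m + 1) → ℝ) (h : a 0 ≠ 0) :
    IsUnit (lowT m a).det := by
  have hL : (lowT m a).IsLowerTriangular := fun i j hij =>
    dif_neg (not_le.mpr hij)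
  rw [det_of_isLowerTriangular _ hL, isUnit_iff_ne_zero, Finset.prod_ne_zero_iff]
  intro i _
  simpa [lowT] using h

theorem isUnit_det_upT (m : ℕ) (a : Fin (m + 1) → ℝ) (h : a (Fin.last m) ≠ 0) :
    IsUnit (upT m a).det := by
  have hU : (upT m a).IsUpperTriangular := fun i j hij => dif_neg (not_le.mpr hij)
  rw [det_of_isUpperTriangular hU, isUnit_iff_ne_zero, Finset.prod_ne_zero_iff]
  intro i _
  simpa [upT, Fin.last] using h

theorem kerT_mul_kMat (m : ℕ) (d : Fin (m + 1) → ℝ) (h₀ : d 0 ≠ 0) (hm : d (Fin.last m) ≠ 0) :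
    kerT m d * kMat m d = 0 := by
  rw [kerT, kMat, submatrix_mul_equiv, fromCols_mul_fromRows, fromCols_mul_fromRows,
    mul_fromCols, mul_fromCols, mul_fromCols]
  have hL := nonsing_inv_mul _ (isUnit_det_lowT m d h₀)
  have hU := nonsing_inv_mul _ (isUnit_det_upT m d hm)
  ext r c
  induction c using Fin.addCases with
  | left c => simp [Matrix.mul_assoc, hL]
  | right c => simp [-Fin.natAdd_eq_addNat, Matrix.mul_assoc, hU]

theorem tSub_mul_Dl (m : ℕ) (hm : 1 ≤ m) (d : Fin (m + 1) → ℝ) (hd : ∀ k, d k ≠ 0) :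
    ∀ i : Fin (m + 1), tSub m d i * dlMat m d = 0 := by
  intro i
  ext r j
  have hK := congrFun₂ (kerT_mul_kMat m d (hd _) (hd _)) r ⟨i + j, by omega⟩
  rw [Matrix.mul_apply] at hK ⊢
  refine Eq.trans (Fintype.sum_of_injective
    (fun c : Fin (m + m) => (⟨i + c, by omega⟩ : Fin (m + m + m))) ?_ _ _ ?_ ?_) hK
  · intro c c' h
    simpa [Fin.ext_iff] using h
  · intro k hk
    rw [kMat_apply, bandEntry_eq_zero, mul_zero]
    by_contra hband
    simp only [not_or, not_lt] at hband
    exact hk ⟨⟨k - i, by omega⟩, Fin.ext (by simp only; omega)⟩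
  · intro c
    rw [kMat_apply, dlMat_apply, bandEntry_add_add, tSub]
end
end

section
/- Let N be the 2m×m block column matrix N = [N_L; N_U]. Then for every i with 1 ≤ i ≤ m+1, the matrix B_i is invertible and A_i · B_i⁻¹ = A_B · N. -/
open Matrix

noncomputable section

theorem dlMat_apply_s7 (m : ℕ) (d : Fin (m + 1) → ℝ) (p : Fin (m + m)) (j : Fin m) :
    dlMat m d p j =
      if h : (j : ℕ) ≤ p ∧ (p : ℕ) ≤ j + m then d ⟨p - j, by omega⟩ else 0 := by
  refine Fin.addCases (fun p => ?_) (fun p => ?_) p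
  · have hp := p.2
    simp only [dlMat, submatrix_apply, finSumFinEquiv_symm_apply_castAdd, fromRows_apply_inl,
      id, lowT, Fin.val_castAdd]
    split_ifs <;> first | rfl | omega
  · have hj := j.2
    simp only [dlMat, submatrix_apply, finSumFinEquiv_symm_apply_natAdd, fromRows_apply_inr,
      id, upT, Fin.val_natAdd]
    split_ifs <;> first | rfl | omega

/-- A solution of the recurrence with coefficients `d` that vanishes on `m` consecutive
indices vanishes identically. -/
theorem eq_zero_of_vecMul_dlMat_eq_zero {m : ℕ} {d : Fin (m + 1) → ℝ}
    (hd₀ : d 0 ≠ 0) (hd₁ : d (Fin.last m) ≠ 0) {y : Fin (m + m) → ℝ}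
    (hy : y ᵥ* dlMat m d = 0) {i : ℕ} (hi : i ≤ m)
    (hz : ∀ p : Fin (m + m), i ≤ (p : ℕ) → (p : ℕ) < i + m → y p = 0) : y = 0 := by
  have forward : ∀ k (hk : k < m + m), i ≤ k → y ⟨k, hk⟩ = 0 := by
    intro k
    induction k using Nat.strong_induction_on with
    | _ k ih =>
      intro hk hik
      by_cases hkm : k < i + m
      · exact hz _ hik hkm
      have h := congrFun hy ⟨k - m, by omega⟩
      simp only [vecMul, dotProduct, Pi.zero_apply] at h
      rw [Finset.sum_eq_single ⟨k, hk⟩, dlMat_apply_s7, dif_pos ⟨by simp, by simp; omega⟩] at h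
      · have hlast : (⟨k - (k - m), by omega⟩ : Fin (m + 1)) = Fin.last m :=
          Fin.ext (by simp; omega)
        simp only [hlast] at h
        exact (mul_eq_zero.mp h).resolve_right hd₁
      · intro q _ hq
        have hq' : (q : ℕ) ≠ k := fun e => hq (Fin.ext e)
        rw [dlMat_apply_s7]
        split_ifs with hc
        · simp only at hc
          rw [ih q (by omega) q.2 (by omega), zero_mul]
        · simp
      · simp
  have backward : ∀ t k (hk : k < m + m), i = k + t → y ⟨k, hk⟩ = 0 := by
    intro t
    induction t using Nat.strong_induction_on with
    | _ t ih =>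
      intro k hk hik
      by_cases hkm : i ≤ k
      · exact forward k hk hkm
      have h := congrFun hy ⟨k, by omega⟩
      simp only [vecMul, dotProduct, Pi.zero_apply] at h
      rw [Finset.sum_eq_single ⟨k, hk⟩, dlMat_apply_s7, dif_pos ⟨by simp, by simp⟩] at h
      · have hfirst : (⟨k - k, by omega⟩ : Fin (m + 1)) = 0 := Fin.ext (by simp)
        simp only [hfirst] at h
        exact (mul_eq_zero.mp h).resolve_right hd₀
      · intro q _ hq
        have hq' : (q : ℕ) ≠ k := fun e => hq (Fin.ext e)
        rw [dlMat_apply_s7]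
        split_ifs with hc
        · simp only at hc
          rcases le_total i q with hiq | hiq
          · rw [forward q q.2 hiq, zero_mul]
          · rw [ih (i - q) (by omega) q q.2 (by omega), zero_mul]
        · simp
      · simp
  funext p
  rcases le_total i p with hip | hip
  · exact forward p p.2 hip
  · exact backward (i - p) p p.2 (by omega)

theorem sylv_submatrix (m : ℕ) (d n : Fin (m + 1) → ℝ) :
    (sylv m d n).submatrix id finSumFinEquiv = fromCols (dlMat m d) (nMat m n) := by
  ext p (j | j) <;> refine Fin.addCases (fun p => ?_) (fun p => ?_) p <;>
    simp [sylv, dlMat, nMat, -Fin.natAdd_eq_addNat]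

theorem dMat_submatrix (m : ℕ) (d : Fin (m + 1) → ℝ) :
    (dMat m d).submatrix id finSumFinEquiv = fromCols (dlMat m d) (drMat m d) := by
  ext p (j | j) <;> refine Fin.addCases (fun p => ?_) (fun p => ?_) p <;>
    simp [dMat, dlMat, drMat, -Fin.natAdd_eq_addNat]

/-- If the columns of `M` are split as `[X | Y]`, the last `m` rows of `M⁻¹` annihilate `X`
and are a left inverse of `Y`. -/
theorem lastRows_inv_mul {m : ℕ} {M : Matrix (Fin (m + m)) (Fin (m + m)) ℝ} (hM : IsUnit M)
    {X Y : Matrix (Fin (m + m)) (Fin m) ℝ}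
    (h : M.submatrix id finSumFinEquiv = fromCols X Y) :
    lastRows m M⁻¹ * X = 0 ∧ lastRows m M⁻¹ * Y = 1 := by
  have hinv : M⁻¹ * M = 1 := nonsing_inv_mul _ ((isUnit_iff_isUnit_det _).mp hM)
  constructor
  · ext r c
    have e := congrFun (congrFun hinv (Fin.natAdd m r)) (Fin.castAdd m c)
    rw [mul_apply] at e
    have hX : ∀ q, X q c = M q (Fin.castAdd m c) := fun q => by
      simpa using (congrFun (congrFun h q) (Sum.inl c)).symm
    rw [one_apply_ne (fun e => by have := congrArg Fin.val e; simp at this; omega)] at e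
    simp only [mul_apply, hX]
    exact e
  · ext r c
    have e := congrFun (congrFun hinv (Fin.natAdd m r)) (Fin.natAdd m c)
    rw [mul_apply] at e
    have hY : ∀ q, Y q c = M q (Fin.natAdd m c) := fun q => by
      simpa using (congrFun (congrFun h q) (Sum.inr c)).symm
    have h1 : (1 : Matrix (Fin (m + m)) (Fin (m + m)) ℝ) (Fin.natAdd m r) (Fin.natAdd m c)
        = (1 : Matrix (Fin m) (Fin m) ℝ) r c := by simp [one_apply]
    rw [h1] at e
    simp only [mul_apply, hY]
    exact e

theorem lastRows_dMat_inv_eq {m : ℕ} {d n : Fin (m + 1) → ℝ}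
    (hS : IsUnit (sylv m d n)) (hD : IsUnit (dMat m d)) :
    lastRows m (dMat m d)⁻¹ =
      lastRows m (dMat m d)⁻¹ * nMat m n * lastRows m (sylv m d n)⁻¹ := by
  obtain ⟨hA, -⟩ := lastRows_inv_mul hD (dMat_submatrix m d)
  obtain ⟨hB, hB'⟩ := lastRows_inv_mul hS (sylv_submatrix m d n)
  have hdet := (isUnit_iff_isUnit_det _).mp hS
  have key : lastRows m (dMat m d)⁻¹ * sylv m d n =
      lastRows m (dMat m d)⁻¹ * nMat m n * lastRows m (sylv m d n)⁻¹ * sylv m d n := by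
    have hmul : ∀ P : Matrix (Fin m) (Fin (m + m)) ℝ, P * sylv m d n =
        (fromCols (P * dlMat m d) (P * nMat m n)).submatrix id finSumFinEquiv.symm := by
      intro P
      rw [← mul_fromCols, ← sylv_submatrix]
      ext r c
      simp [mul_apply]
    rw [hmul, hmul, hA, Matrix.mul_assoc _ _ (dlMat m d), hB, Matrix.mul_assoc _ _ (nMat m n),
      hB', Matrix.mul_zero, Matrix.mul_one]
  have := congrArg (· * (sylv m d n)⁻¹) key
  simpa only [Matrix.mul_assoc, mul_nonsing_inv _ hdet, Matrix.mul_one] using this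

theorem isUnit_subCols_lastRows_sylv_inv {m : ℕ} {d n : Fin (m + 1) → ℝ}
    (hd₀ : d 0 ≠ 0) (hd₁ : d (Fin.last m) ≠ 0) (hS : IsUnit (sylv m d n)) (i : Fin (m + 1)) :
    IsUnit (subCols m (lastRows m (sylv m d n)⁻¹) i) := by
  obtain ⟨hB, hB'⟩ := lastRows_inv_mul hS (sylv_submatrix m d n)
  rw [← vecMul_injective_iff_isUnit, ← coe_vecMulLinear, injective_iff_map_eq_zero]
  intro w hw
  have hy : w ᵥ* lastRows m (sylv m d n)⁻¹ = 0 := by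
    refine eq_zero_of_vecMul_dlMat_eq_zero hd₀ hd₁ ?_ (Nat.le_of_lt_succ i.2) ?_
    · rw [vecMul_vecMul, hB, vecMul_zero]
    · intro p hip hpi
      have e := congrFun hw ⟨p - i, by omega⟩
      have hp : (⟨i + (p - i), by omega⟩ : Fin (m + m)) = p := Fin.ext (by simp; omega)
      simpa only [vecMulLinear_apply, vecMul, dotProduct, subCols, hp, Pi.zero_apply] using e
  rw [← vecMul_one w, ← hB', ← vecMul_vecMul, hy, zero_vecMul]

theorem aSub_mul_inv_bSub (m : ℕ) (hm : 1 ≤ m) (d n : Fin (m + 1) → ℝ) (hd : ∀ k, d k ≠ 0) (hn : ∀ k, n k ≠ 0)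
    (hS : IsUnit (sylv m d n)) (hD : IsUnit (dMat m d)) :
    ∀ i : Fin (m + 1),
      IsUnit (subCols m (lastRows m (sylv m d n)⁻¹) i) ∧
        subCols m (lastRows m (dMat m d)⁻¹) i * (subCols m (lastRows m (sylv m d n)⁻¹) i)⁻¹ = (lastRows m (dMat m d)⁻¹) * nMat m n := by
  intro i
  have hB := isUnit_subCols_lastRows_sylv_inv (hd 0) (hd (Fin.last m)) hS i
  refine ⟨hB, ?_⟩
  have hA : subCols m (lastRows m (dMat m d)⁻¹) i =
      lastRows m (dMat m d)⁻¹ * nMat m n * subCols m (lastRows m (sylv m d n)⁻¹) i := by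
    ext r c
    exact congrFun (congrFun (lastRows_dMat_inv_eq hS hD) r) _
  rw [hA, Matrix.mul_assoc, mul_nonsing_inv _ ((isUnit_iff_isUnit_det _).mp hB), Matrix.mul_one]
end
end

section
/- Shift invariance for A: for all i, j with 1 ≤ i, j ≤ m+1 and every integer k ≥ 0 with i+k ≤ m+1 and j+k ≤ m+1, the matrices A_i and A_{i+k} are invertible and A_i⁻¹ · A_j = (A_{i+k})⁻¹ · A_{j+k}. -/
open Matrix

noncomputable section

/-- The banded Toeplitz description of the first `m` columns of `dMat`. -/
theorem dMat_apply_of_lt (m : ℕ) (d : Fin (m + 1) → ℝ) (l c : Fin (m + m)) (hc : (c : ℕ) < m) :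
    dMat m d l c =
      if h : (c : ℕ) ≤ l ∧ (l : ℕ) ≤ c + m then d ⟨(l : ℕ) - c, by omega⟩ else 0 := by
  obtain ⟨c, rfl⟩ : ∃ c' : Fin m, c = Fin.castAdd m c' := ⟨⟨c, hc⟩, rfl⟩
  induction l using Fin.addCases with
  | left l =>
    simp only [dMat, submatrix_apply, finSumFinEquiv_symm_apply_castAdd, fromBlocks_apply₁₁, lowT,
      Fin.val_castAdd]
    split_ifs <;> first | rfl | omega
  | right l =>
    simp only [dMat, submatrix_apply, finSumFinEquiv_symm_apply_castAdd,
      finSumFinEquiv_symm_apply_natAdd, fromBlocks_apply₂₁, upT, Fin.val_castAdd, Fin.val_natAdd]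
    split_ifs <;> first | rfl | omega

theorem sum_mul_dMat_of_lt (m : ℕ) (d : Fin (m + 1) → ℝ) (f : Fin (m + m) → ℝ)
    (c : Fin (m + m)) (hc : (c : ℕ) < m) :
    ∑ l, f l * dMat m d l c = ∑ k : Fin (m + 1), f ⟨(c : ℕ) + k, by omega⟩ * d k := by
  symm
  refine Finset.sum_of_injOn (fun k : Fin (m + 1) => (⟨(c : ℕ) + k, by omega⟩ : Fin (m + m)))
    ?_ (by simp) ?_ ?_
  · intro x _ y _ h
    simp only [Fin.mk.injEq] at h
    exact Fin.ext (by omega)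
  · intro l _ hl
    rw [dMat_apply_of_lt m d l c hc, dif_neg, mul_zero]
    rintro ⟨h1, h2⟩
    refine hl ⟨⟨(l : ℕ) - c, by omega⟩, by simp, Fin.ext ?_⟩
    simp only
    omega
  · intro k _
    rw [dMat_apply_of_lt m d _ c hc, dif_pos ⟨by simp, by simp; omega⟩]
    simp

/-- The columns of `lastRows m (dMat m d)⁻¹` satisfy the linear recurrence with coefficients `d`. -/
theorem sum_lastRows_inv_dMat (m : ℕ) (d : Fin (m + 1) → ℝ) (hD : IsUnit (dMat m d))
    (r : Fin m) (i : ℕ) (hi : i < m) :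
    ∑ k : Fin (m + 1), lastRows m (dMat m d)⁻¹ r ⟨i + k, by omega⟩ * d k = 0 := by
  have h := congrFun (congrFun (nonsing_inv_mul _ ((isUnit_iff_isUnit_det _).1 hD))
    ⟨m + r, by omega⟩) ⟨i, by omega⟩
  rw [mul_apply, sum_mul_dMat_of_lt m d _ _ hi, one_apply_ne (by simp; omega)] at h
  exact h

theorem subCols_last_mul_lowT (m : ℕ) (d : Fin (m + 1) → ℝ) (hD : IsUnit (dMat m d)) :
    subCols m (lastRows m (dMat m d)⁻¹) (Fin.last m) * lowT m d = 1 := by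
  ext r c
  have h := congrFun (congrFun (nonsing_inv_mul _ ((isUnit_iff_isUnit_det _).1 hD))
    (Fin.natAdd m r)) (Fin.natAdd m c)
  rw [mul_apply, Fin.sum_univ_add] at h
  simp only [dMat, submatrix_apply, finSumFinEquiv_symm_apply_castAdd,
    finSumFinEquiv_symm_apply_natAdd, fromBlocks_apply₁₂, fromBlocks_apply₂₂, Matrix.zero_apply,
    mul_zero, Finset.sum_const_zero, zero_add, one_apply, Fin.natAdd_inj] at h
  rw [mul_apply, one_apply, ← h]
  rfl

/-- Companion matrix of the recurrence with coefficients `d`. -/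
def companionT (p : ℕ) (d : Fin (p + 2) → ℝ) : Matrix (Fin (p + 1)) (Fin (p + 1)) ℝ :=
  fun l c => Fin.cases (-d l.succ / d 0) (fun c' : Fin p => if l = c'.castSucc then 1 else 0) c

theorem isUnit_companionT (p : ℕ) (d : Fin (p + 2) → ℝ) (hd : ∀ k, d k ≠ 0) :
    IsUnit (companionT p d) := by
  rw [← mulVec_injective_iff_isUnit]
  refine (injective_iff_map_eq_zero (companionT p d).mulVecLin).2 fun v hv => ?_
  have hrow (l : Fin (p + 1)) :
      -d l.succ / d 0 * v 0 + ∑ c : Fin p, (if l = c.castSucc then 1 else 0) * v c.succ = 0 := by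
    have h := congrFun hv l
    simpa only [mulVecLin_apply, mulVec, dotProduct, Fin.sum_univ_succ, companionT,
      Fin.cases_zero, Fin.cases_succ, Pi.zero_apply] using h
  have h0 : v 0 = 0 := by
    have h := hrow (Fin.last p)
    simpa [(Fin.castSucc_ne_last _).symm, hd] using h
  funext c
  induction c using Fin.cases with
  | zero => exact h0
  | succ c => simpa [h0] using hrow c.castSucc

theorem subCols_eq_mul_companionT (p : ℕ) (d : Fin (p + 2) → ℝ) (hd : ∀ k, d k ≠ 0)
    (hD : IsUnit (dMat (p + 1) d)) (i : ℕ) (hi : i < p + 1) :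
    subCols (p + 1) (lastRows (p + 1) (dMat (p + 1) d)⁻¹) ⟨i, by omega⟩ =
      subCols (p + 1) (lastRows (p + 1) (dMat (p + 1) d)⁻¹) ⟨i + 1, by omega⟩ *
        companionT p d := by
  ext r c
  rw [mul_apply]
  induction c using Fin.cases with
  | zero =>
    have h := sum_lastRows_inv_dMat (p + 1) d hD r i hi
    rw [Fin.sum_univ_succ, ← eq_neg_iff_add_eq_zero, ← eq_div_iff (hd 0)] at h
    refine h.trans ?_
    rw [← Finset.sum_neg_distrib, Finset.sum_div]
    refine Finset.sum_congr rfl fun l _ => ?_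
    have e : i + (l.succ : ℕ) = i + 1 + l := by simp; omega
    simp only [companionT, Fin.cases_zero, subCols, e]
    ring
  | succ c =>
    have e : i + (c.succ : ℕ) = i + 1 + c := by simp; omega
    simp only [companionT, Fin.cases_succ, subCols, e, mul_ite, mul_one, mul_zero,
      Finset.sum_ite_eq', Finset.mem_univ, if_true, Fin.val_castSucc]

theorem subCols_eq_last_mul_pow (p : ℕ) (d : Fin (p + 2) → ℝ) (hd : ∀ k, d k ≠ 0)
    (hD : IsUnit (dMat (p + 1) d)) (s : ℕ) (i : Fin (p + 2)) (hs : (i : ℕ) + s = p + 1) :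
    subCols (p + 1) (lastRows (p + 1) (dMat (p + 1) d)⁻¹) i =
      subCols (p + 1) (lastRows (p + 1) (dMat (p + 1) d)⁻¹) (Fin.last (p + 1)) *
        companionT p d ^ s := by
  induction s generalizing i with
  | zero =>
    obtain rfl : i = Fin.last (p + 1) := Fin.ext (by simpa using hs)
    simp
  | succ s ih =>
    rw [pow_succ, ← mul_assoc, ← ih ⟨i + 1, by omega⟩ (by simp only; omega)]
    exact subCols_eq_mul_companionT p d hd hD i (by omega)

theorem shift_invariance_A (m : ℕ) (hm : 1 ≤ m) (d n : Fin (m + 1) → ℝ) (hd : ∀ k, d k ≠ 0) (hn : ∀ k, n k ≠ 0)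
    (hS : IsUnit (sylv m d n)) (hD : IsUnit (dMat m d)) :
    ∀ i j : Fin (m + 1), ∀ k : ℕ,
      ∀ (hik : (i : ℕ) + k ≤ m) (hjk : (j : ℕ) + k ≤ m),
        IsUnit (subCols m (lastRows m (dMat m d)⁻¹) i) ∧
          IsUnit (subCols m (lastRows m (dMat m d)⁻¹) ⟨(i : ℕ) + k, by omega⟩) ∧
            (subCols m (lastRows m (dMat m d)⁻¹) i)⁻¹ * subCols m (lastRows m (dMat m d)⁻¹) j =
              (subCols m (lastRows m (dMat m d)⁻¹) ⟨(i : ℕ) + k, by omega⟩)⁻¹ *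
                subCols m (lastRows m (dMat m d)⁻¹) ⟨(j : ℕ) + k, by omega⟩ := by
  obtain ⟨p, rfl⟩ : ∃ p, m = p + 1 := ⟨m - 1, by omega⟩
  intro i j k hik hjk
  have hB : IsUnit (subCols (p + 1) (lastRows (p + 1) (dMat (p + 1) d)⁻¹) (Fin.last (p + 1))) :=
    IsUnit.of_mul_eq_one _ (subCols_last_mul_lowT (p + 1) d hD)
  have hC := isUnit_companionT p d hd
  have hpow := subCols_eq_last_mul_pow p d hd hD
  obtain ⟨s, hs⟩ := Nat.exists_eq_add_of_le hik
  obtain ⟨t, ht⟩ := Nat.exists_eq_add_of_le hjk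
  rw [hpow (s + k) i (by omega), hpow s ⟨i + k, by omega⟩ (by simp only; omega),
    hpow (t + k) j (by omega), hpow t ⟨j + k, by omega⟩ (by simp only; omega)]
  refine ⟨hB.mul (hC.pow _), hB.mul (hC.pow _), ?_⟩
  have hBdet := (isUnit_iff_isUnit_det _).1 hB
  have hkdet := (isUnit_iff_isUnit_det _).1 (hC.pow k)
  rw [Matrix.mul_inv_rev, Matrix.mul_inv_rev, mul_assoc, mul_assoc, nonsing_inv_mul_cancel_left _ _ hBdet,
    nonsing_inv_mul_cancel_left _ _ hBdet, add_comm t k, add_comm s k, pow_add,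
    pow_add, Matrix.mul_inv_rev, mul_assoc,
    nonsing_inv_mul_cancel_left _ _ hkdet]
end
end

section
/- Shift invariance for B: for all i, j with 1 ≤ i, j ≤ m+1 and every integer k ≥ 0 with i+k ≤ m+1 and j+k ≤ m+1, the matrices B_i and B_{i+k} are invertible and B_i⁻¹ · B_j = (B_{i+k})⁻¹ · B_{j+k}. In particular B_1⁻¹·B_2 = B_2⁻¹·B_3 = … = B_m⁻¹·B_{m+1}. -/
open Matrix

noncomputable section

/-- The columns of `[D_L; D_U]` are the shifts of the coefficient sequence. -/
theorem sylv_castAdd (m : ℕ) (d n : Fin (m + 1) → ℝ) (t : Fin (m + m)) (j : Fin m) :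
    sylv m d n t (Fin.castAdd m j) =
      if h : (j : ℕ) ≤ t ∧ (t : ℕ) ≤ j + m then d ⟨t - j, by omega⟩ else 0 := by
  induction t using Fin.addCases with
  | left t =>
    have ht := t.2
    simp only [sylv, submatrix_apply, finSumFinEquiv_symm_apply_castAdd, fromBlocks_apply₁₁, lowT,
      Fin.val_castAdd]
    split_ifs <;> first | rfl | omega
  | right t =>
    have hj := j.2
    simp only [sylv, submatrix_apply, finSumFinEquiv_symm_apply_castAdd,
      finSumFinEquiv_symm_apply_natAdd, fromBlocks_apply₂₁, upT, Fin.val_natAdd]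
    split_ifs <;> first | rfl | omega

theorem sum_lastRows_sylv_inv (m : ℕ) (d n : Fin (m + 1) → ℝ) (hS : IsUnit (sylv m d n))
    (r j : Fin m) :
    ∑ k : Fin (m + 1), lastRows m (sylv m d n)⁻¹ r ⟨j + k, by omega⟩ * d k = 0 := by
  have hS' := (Matrix.isUnit_iff_isUnit_det _).1 hS
  have h := congrFun (congrFun (nonsing_inv_mul _ hS') (Fin.natAdd m r)) (Fin.castAdd m j)
  rw [one_apply_ne (by simp [Fin.ext_iff]; omega), mul_apply] at h
  rw [← h]
  refine Fintype.sum_of_injective (fun k : Fin (m + 1) => (⟨j + k, by omega⟩ : Fin (m + m)))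
    (fun a b hab => by simpa [Fin.ext_iff] using hab) _ _ (fun t ht => ?_) (fun k => ?_)
  · rw [sylv_castAdd, dif_neg, mul_zero]
    rintro ⟨h₁, h₂⟩
    exact ht ⟨⟨t - j, by omega⟩, Fin.ext (by simp; omega)⟩
  · have hk : (j : ℕ) + k ≤ j + m := by omega
    rw [sylv_castAdd]
    simp [lastRows, hk, Fin.natAdd]

theorem subCols_mul_add_subCols_mul (m : ℕ) (d n : Fin (m + 1) → ℝ) (hS : IsUnit (sylv m d n)) :
    subCols m (lastRows m (sylv m d n)⁻¹) 0 * lowT m n +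
      subCols m (lastRows m (sylv m d n)⁻¹) (Fin.last m) * upT m n = 1 := by
  have hS' := (Matrix.isUnit_iff_isUnit_det _).1 hS
  ext r c
  have h := congrFun (congrFun (nonsing_inv_mul _ hS') (Fin.natAdd m r)) (Fin.natAdd m c)
  rw [mul_apply, Fin.sum_univ_add] at h
  simp only [one_apply, Fin.natAdd_inj] at h
  rw [one_apply, ← h, Matrix.add_apply, mul_apply, mul_apply]
  congr 1 <;> refine Finset.sum_congr rfl fun t _ => ?_
  · have ht : sylv m d n (Fin.castAdd m t) (Fin.natAdd m c) = lowT m n t c := by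
      simp only [sylv, submatrix_apply, finSumFinEquiv_symm_apply_castAdd,
        finSumFinEquiv_symm_apply_natAdd, fromBlocks_apply₁₂]
    rw [ht]
    simp [subCols, lastRows, Fin.natAdd, Fin.castAdd, Fin.castLE]
  · have ht : sylv m d n (Fin.natAdd m t) (Fin.natAdd m c) = upT m n t c := by
      simp only [sylv, submatrix_apply, finSumFinEquiv_symm_apply_natAdd, fromBlocks_apply₂₂]
    rw [ht]
    simp [subCols, lastRows, Fin.natAdd]

/-- The companion matrix of `∑ k, d k * X ^ k`: right multiplication by it advances a window of
consecutive terms of a sequence satisfying the recurrence with coefficients `d`. -/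
def companionFwd (m : ℕ) (d : Fin (m + 1) → ℝ) : Matrix (Fin m) (Fin m) ℝ :=
  fun r c => if (c : ℕ) + 1 < m then (if (r : ℕ) = c + 1 then 1 else 0)
    else -d r.castSucc / d (Fin.last m)

/-- The matrix moving a window of consecutive terms one step back. -/
def companionBwd (m : ℕ) (d : Fin (m + 1) → ℝ) : Matrix (Fin m) (Fin m) ℝ :=
  fun r c => if 0 < (c : ℕ) then (if (r : ℕ) + 1 = c then 1 else 0)
    else -d r.succ / d 0

section Recurrence

variable {m : ℕ} {d : Fin (m + 1) → ℝ} {M : Matrix (Fin m) (Fin (m + m)) ℝ}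

theorem subCols_mul_companionFwd (hd : d (Fin.last m) ≠ 0)
    (hM : ∀ r j : Fin m, ∑ k : Fin (m + 1), M r ⟨j + k, by omega⟩ * d k = 0)
    (i : ℕ) (hi : i < m) :
    subCols m M ⟨i, by omega⟩ * companionFwd m d = subCols m M ⟨i + 1, by omega⟩ := by
  ext r c
  simp only [mul_apply, subCols, companionFwd]
  split_ifs with hc
  · rw [Finset.sum_eq_single ⟨c + 1, hc⟩]
    · simp [add_assoc, add_comm 1]
    · intro b _ hb
      rw [if_neg (fun h => hb (Fin.ext h)), mul_zero]
    · simp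
  · have h := hM r ⟨i, hi⟩
    rw [Fin.sum_univ_castSucc] at h
    have hcm : i + 1 + (c : ℕ) = i + m := by omega
    simp only [Fin.val_castSucc, Fin.val_last, hcm] at h ⊢
    simp only [mul_div_assoc', mul_neg, ← Finset.sum_div, Finset.sum_neg_distrib]
    rw [div_eq_iff hd]
    linarith

theorem subCols_mul_companionBwd (hd : d 0 ≠ 0)
    (hM : ∀ r j : Fin m, ∑ k : Fin (m + 1), M r ⟨j + k, by omega⟩ * d k = 0)
    (i : ℕ) (hi : i < m) :
    subCols m M ⟨i + 1, by omega⟩ * companionBwd m d = subCols m M ⟨i, by omega⟩ := by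
  ext r c
  simp only [mul_apply, subCols, companionBwd]
  split_ifs with hc
  · rw [Finset.sum_eq_single ⟨c - 1, by omega⟩]
    · have h₁ : (c : ℕ) - 1 + 1 = c := by omega
      have h₂ : i + 1 + ((c : ℕ) - 1) = i + c := by omega
      simp [h₁, h₂]
    · intro b _ hb
      rw [if_neg (fun h => hb (Fin.ext (by simp; omega))), mul_zero]
    · simp
  · have h := hM r ⟨i, hi⟩
    rw [Fin.sum_univ_succ] at h
    have hc0 : (c : ℕ) = 0 := by omega
    simp only [Fin.val_zero, Fin.val_succ, hc0, add_assoc, add_comm 1] at h ⊢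
    simp only [mul_div_assoc', mul_neg, ← Finset.sum_div, Finset.sum_neg_distrib]
    rw [div_eq_iff hd]
    linarith

theorem subCols_eq_mul_companionFwd_pow (hd : d (Fin.last m) ≠ 0)
    (hM : ∀ r j : Fin m, ∑ k : Fin (m + 1), M r ⟨j + k, by omega⟩ * d k = 0)
    (i : ℕ) (hi : i < m + 1) :
    subCols m M ⟨i, hi⟩ = subCols m M 0 * companionFwd m d ^ i := by
  induction i with
  | zero => simp
  | succ i ih =>
    rw [← subCols_mul_companionFwd hd hM i (by omega), ih (by omega), pow_succ, Matrix.mul_assoc]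

end Recurrence

theorem shift_invariance_B (m : ℕ) (hm : 1 ≤ m) (d n : Fin (m + 1) → ℝ) (hd : ∀ k, d k ≠ 0) (hn : ∀ k, n k ≠ 0)
    (hS : IsUnit (sylv m d n)) (hD : IsUnit (dMat m d)) :
    (∀ i j : Fin (m + 1), ∀ k : ℕ,
      ∀ (hik : (i : ℕ) + k ≤ m) (hjk : (j : ℕ) + k ≤ m),
        IsUnit (subCols m (lastRows m (sylv m d n)⁻¹) i) ∧
          IsUnit (subCols m (lastRows m (sylv m d n)⁻¹) ⟨(i : ℕ) + k, by omega⟩) ∧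
            (subCols m (lastRows m (sylv m d n)⁻¹) i)⁻¹ * subCols m (lastRows m (sylv m d n)⁻¹) j =
              (subCols m (lastRows m (sylv m d n)⁻¹) ⟨(i : ℕ) + k, by omega⟩)⁻¹ *
                subCols m (lastRows m (sylv m d n)⁻¹) ⟨(j : ℕ) + k, by omega⟩) ∧
      ∀ i : Fin (m + 1), ∀ (hi : (i : ℕ) < m),
        (subCols m (lastRows m (sylv m d n)⁻¹) i)⁻¹ * subCols m (lastRows m (sylv m d n)⁻¹) ⟨(i : ℕ) + 1, by omega⟩ =
          (subCols m (lastRows m (sylv m d n)⁻¹) ⟨0, by omega⟩)⁻¹ * subCols m (lastRows m (sylv m d n)⁻¹) ⟨1, by omega⟩ := by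
  have hM := sum_lastRows_sylv_inv m d n hS
  have hN := subCols_mul_add_subCols_mul m d n hS
  have hbwd := subCols_mul_companionBwd (hd 0) hM 0 (by omega)
  have hpow := subCols_eq_mul_companionFwd_pow (hd (Fin.last m)) hM
  generalize lastRows m (sylv m d n)⁻¹ = M at *
  set C := companionFwd m d
  have hB : IsUnit (subCols m M 0) := by
    rw [Fin.last, hpow m (by omega), Matrix.mul_assoc, ← Matrix.mul_add] at hN
    exact IsUnit.of_mul_eq_one _ hN
  have hC : IsUnit C := by
    rw [hpow (0 + 1) (by omega), zero_add, pow_one, Matrix.mul_assoc] at hbwd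
    exact IsUnit.of_mul_eq_one _ (hB.mul_left_cancel (hbwd.trans (mul_one _).symm))
  have hunit (i : ℕ) (hi : i < m + 1) : IsUnit (subCols m M ⟨i, hi⟩) := by
    rw [hpow i hi]
    exact hB.mul (hC.pow i)
  have hshift (i j k : ℕ) (hik : i + k ≤ m) (hjk : j + k ≤ m) :
      (subCols m M ⟨i, by omega⟩)⁻¹ * subCols m M ⟨j, by omega⟩ =
        (subCols m M ⟨i + k, by omega⟩)⁻¹ * subCols m M ⟨j + k, by omega⟩ := by
    have hBdet := (Matrix.isUnit_iff_isUnit_det _).1 hB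
    have hCdet := (Matrix.isUnit_iff_isUnit_det _).1 (hC.pow k)
    rw [hpow i, hpow j, hpow (i + k), hpow (j + k), add_comm i, add_comm j, pow_add, pow_add]
    simp only [Matrix.mul_inv_rev, Matrix.mul_assoc]
    rw [nonsing_inv_mul_cancel_left _ _ hBdet, nonsing_inv_mul_cancel_left _ _ hBdet,
      nonsing_inv_mul_cancel_left _ _ hCdet]
  refine ⟨fun i j k hik hjk => ⟨hunit i i.2, hunit _ _, hshift i j k hik hjk⟩, fun i hi => ?_⟩
  have h := hshift 0 1 i (by omega) (by omega)
  simp only [zero_add, add_comm 1] at h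
  exact h.symm
end
end

section
/- Let D_r be the 2m×m block column matrix D_r = [0; D_L]. Then for every j with 1 ≤ j ≤ m+1, the matrix A_j is invertible and A_j⁻¹ = T_{m−j+2} · D_r. -/
open Matrix

noncomputable section

/-- Column `i` of `kerT m d`, extended by zero beyond the last column. -/
def kerCol (m : ℕ) (d : Fin (m + 1) → ℝ) (i : ℕ) : Fin m → ℝ :=
  fun r => if h : i < m + m + m then kerT m d r ⟨i, h⟩ else 0

/-- The square submatrix of `kerT m d` with the `m` columns starting from column `i`. -/
def kerWindow (m : ℕ) (d : Fin (m + 1) → ℝ) (i : ℕ) : Matrix (Fin m) (Fin m) ℝ :=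
  of fun r c => kerCol m d (i + c) r

theorem kerCol_of_lt {m : ℕ} (d : Fin (m + 1) → ℝ) {i : ℕ} (h : i < m + m + m) (r : Fin m) :
    kerCol m d i r = kerT m d r ⟨i, h⟩ := dif_pos h

theorem isUnit_lowT {m : ℕ} {d : Fin (m + 1) → ℝ} (h : d 0 ≠ 0) : IsUnit (lowT m d) := by
  have htri : (lowT m d).det = ∏ i, lowT m d i i :=
    det_of_isLowerTriangular _ fun i j (hij : i < j) => dif_neg (by
      have : (i : ℕ) < j := hij
      omega)
  rw [isUnit_iff_isUnit_det, htri, isUnit_iff_ne_zero]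
  refine Finset.prod_ne_zero_iff.2 fun i _ => ?_
  simpa [lowT] using h

theorem isUnit_upT {m : ℕ} {d : Fin (m + 1) → ℝ} (h : d (Fin.last m) ≠ 0) :
    IsUnit (upT m d) := by
  have htri : (upT m d).det = ∏ i, upT m d i i :=
    det_of_isUpperTriangular fun i j (hij : j < i) => dif_neg (by
      have : (j : ℕ) < i := hij
      omega)
  rw [isUnit_iff_isUnit_det, htri, isUnit_iff_ne_zero]
  refine Finset.prod_ne_zero_iff.2 fun i _ => ?_
  simpa [upT, Fin.last] using h

theorem kerT_mul_kMat_s10 {m : ℕ} {d : Fin (m + 1) → ℝ} (hL : IsUnit (lowT m d))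
    (hU : IsUnit (upT m d)) : kerT m d * kMat m d = 0 := by
  have hL' := (isUnit_iff_isUnit_det _).1 hL
  have hU' := (isUnit_iff_isUnit_det _).1 hU
  rw [kerT, kMat, submatrix_mul_equiv, fromCols_mul_fromRows, fromCols_mul_fromRows]
  simp only [mul_fromCols, neg_mul, one_mul, Matrix.mul_zero, neg_zero,
    nonsing_inv_mul_cancel_right _ _ hL', nonsing_inv_mul_cancel_right _ _ hU']
  ext i j
  rcases h : finSumFinEquiv.symm j with k | k <;> simp [h]

theorem kMat_apply_s10 {m : ℕ} (d : Fin (m + 1) → ℝ) (r : Fin (m + m + m)) (c : Fin (m + m)) :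
    kMat m d r c =
      if h : (c : ℕ) ≤ r ∧ (r : ℕ) ≤ c + m then d ⟨r - c, by omega⟩ else 0 := by
  induction r using Fin.addCases with
  | left r =>
    induction r using Fin.addCases <;> induction c using Fin.addCases <;>
      simp [-Fin.natAdd_eq_addNat, kMat, lowT, upT] <;> grind
  | right r =>
    induction c using Fin.addCases <;> simp [-Fin.natAdd_eq_addNat, kMat, upT] <;> grind

theorem sum_smul_kerCol {m : ℕ} {d : Fin (m + 1) → ℝ} (hL : IsUnit (lowT m d))
    (hU : IsUnit (upT m d)) {i : ℕ} (hi : i < m + m) :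
    ∑ k : Fin (m + 1), d k • kerCol m d (i + k) = 0 := by
  ext r
  have h := congrFun (congrFun (kerT_mul_kMat_s10 hL hU) r) ⟨i, hi⟩
  rw [mul_apply, Matrix.zero_apply] at h
  rw [Finset.sum_apply, Pi.zero_apply, ← h]
  have hlt (k : Fin (m + 1)) : i + (k : ℕ) < m + m + m := by omega
  refine Finset.sum_of_injOn (fun k => ⟨i + k, hlt k⟩) ?_ (by simp) ?_ ?_
  · intro a _ b _ hab
    simpa [Fin.ext_iff] using hab
  · intro s _ hs
    rw [kMat_apply_s10, dif_neg, mul_zero]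
    rintro ⟨h₁, h₂⟩
    refine hs ⟨⟨s - i, by simp at h₁ h₂; omega⟩, by simp, ?_⟩
    simp at h₁
    simp [h₁]
  · intro k _
    rw [kMat_apply_s10, dif_pos (by simp; omega)]
    simp [kerCol_of_lt d (hlt k), mul_comm]

theorem kerCol_add_eq_single {m : ℕ} (d : Fin (m + 1) → ℝ) (c : Fin m) :
    kerCol m d (m + c) = Pi.single c 1 := by
  ext r
  have h : (⟨m + c, by omega⟩ : Fin (m + m + m)) = Fin.castAdd m (Fin.natAdd m c) := rfl
  rw [kerCol_of_lt d (by omega), h]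
  simp [-Fin.natAdd_eq_addNat, kerT, one_apply, Pi.single_apply]

/-- The window starting at column `j` acts on the columns as a shift by `j - m`. -/
theorem kerWindow_mulVec_kerCol {m : ℕ} {d : Fin (m + 1) → ℝ} (hL : IsUnit (lowT m d))
    (hU : IsUnit (upT m d)) (hd : d (Fin.last m) ≠ 0) {j : ℕ} (hj : j ≤ m) (i : ℕ)
    (hi : i < m + m) : kerWindow m d j *ᵥ kerCol m d (m + i) = kerCol m d (j + i) := by
  induction i using Nat.strong_induction_on with
  | _ i ih =>
    rcases lt_or_ge i m with him | him
    · rw [kerCol_add_eq_single d ⟨i, him⟩, mulVec_single_one]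
      rfl
    · obtain ⟨i, rfl⟩ := Nat.exists_eq_add_of_le him
      have h₁ := congrArg (kerWindow m d j *ᵥ ·) (sum_smul_kerCol hL hU hi)
      have h₂ := sum_smul_kerCol hL hU (i := j + i) (by omega)
      rw [Fin.sum_univ_castSucc] at h₁ h₂
      simp only [mulVec_add, mulVec_sum, mulVec_smul, mulVec_zero, Fin.val_castSucc,
        Fin.val_last] at h₁ h₂
      have hsum : ∑ k : Fin m, d k.castSucc • kerWindow m d j *ᵥ kerCol m d (m + i + k) =
          ∑ k : Fin m, d k.castSucc • kerCol m d (j + i + k) :=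
        Finset.sum_congr rfl fun k _ => by
          rw [add_assoc m, ih (i + k) (by omega) (by omega), add_assoc j]
      rw [hsum, ← h₂, add_right_inj] at h₁
      have h₃ := smul_right_injective _ hd h₁
      rwa [show m + i + m = m + (m + i) by omega, show j + i + m = j + (m + i) by omega] at h₃

theorem kerWindow_mul_kerWindow {m : ℕ} {d : Fin (m + 1) → ℝ} (hL : IsUnit (lowT m d))
    (hU : IsUnit (upT m d)) (hd : d (Fin.last m) ≠ 0) {j : ℕ} (hj : j ≤ m) :
    kerWindow m d j * kerWindow m d (m + (m - j)) = 1 := by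
  ext r c
  have h := congrFun
    (kerWindow_mulVec_kerCol hL hU hd hj (m - j + c) (by omega)) r
  rw [show j + (m - j + c) = m + c by omega, kerCol_add_eq_single, ← add_assoc] at h
  rw [one_apply, ← Pi.single_apply c (1 : ℝ) r, ← h]
  rfl

theorem subCols_lastRows_inv_dMat {m : ℕ} (d : Fin (m + 1) → ℝ) (j : Fin (m + 1)) :
    subCols m (lastRows m (dMat m d)⁻¹) j = (lowT m d)⁻¹ * kerWindow m d j := by
  have hinv : (dMat m d)⁻¹ = (fromBlocks (lowT m d)⁻¹ 0
      (-((lowT m d)⁻¹ * upT m d * (lowT m d)⁻¹)) (lowT m d)⁻¹).submatrix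
        finSumFinEquiv.symm finSumFinEquiv.symm := by
    rw [dMat, inv_submatrix_equiv, inv_fromBlocks_zero₁₂_of_isUnit_iff _ _ _ Iff.rfl]
  ext r c
  have hrow : (⟨m + r, by omega⟩ : Fin (m + m)) = Fin.natAdd m r := rfl
  rw [subCols, lastRows, hinv, hrow, mul_apply]
  have hjc : (j : ℕ) + c < m + m := by omega
  have hcol (k : Fin m) : kerWindow m d j k c = kerT m d k (Fin.castAdd m ⟨j + c, hjc⟩) :=
    kerCol_of_lt d (by omega) k
  simp only [hcol]
  generalize (⟨j + c, hjc⟩ : Fin (m + m)) = s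
  induction s using Fin.addCases with
  | left s => simp [-Fin.natAdd_eq_addNat, kerT, Matrix.mul_assoc, mul_apply (M := (lowT m d)⁻¹)]
  | right s => simp [-Fin.natAdd_eq_addNat, kerT, one_apply]

theorem tSub_mul_drMat {m : ℕ} (d : Fin (m + 1) → ℝ) (i : Fin (m + 1)) :
    tSub m d i * drMat m d = kerWindow m d (m + i) * lowT m d := by
  ext r c
  simp only [mul_apply, Fin.sum_univ_add]
  have hcol (k : Fin m) : kerWindow m d (m + i) r k = tSub m d i r (Fin.natAdd m k) := by
    simp only [kerWindow, of_apply, tSub, Fin.val_natAdd]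
    rw [kerCol_of_lt d (by omega)]
    congr 2
    omega
  simp [-Fin.natAdd_eq_addNat, drMat, hcol]

theorem aSub_inv_eq (m : ℕ) (hm : 1 ≤ m) (d n : Fin (m + 1) → ℝ) (hd : ∀ k, d k ≠ 0) (hn : ∀ k, n k ≠ 0)
    (hD : IsUnit (dMat m d)) :
    ∀ j : Fin (m + 1),
      IsUnit (subCols m (lastRows m (dMat m d)⁻¹) j) ∧
        (subCols m (lastRows m (dMat m d)⁻¹) j)⁻¹ = tSub m d (revIdx m j) * drMat m d := by
  intro j
  have hL : IsUnit (lowT m d) := isUnit_lowT (hd 0)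
  have hU : IsUnit (upT m d) := isUnit_upT (hd _)
  have hmul : subCols m (lastRows m (dMat m d)⁻¹) j * (tSub m d (revIdx m j) * drMat m d) = 1 := by
    rw [subCols_lastRows_inv_dMat, tSub_mul_drMat, Matrix.mul_assoc,
      ← Matrix.mul_assoc (kerWindow m d j), revIdx,
      kerWindow_mul_kerWindow hL hU (hd _) (Nat.le_of_lt_succ j.2), Matrix.one_mul,
      nonsing_inv_mul _ ((isUnit_iff_isUnit_det _).1 hL)]
  exact ⟨IsUnit.of_mul_eq_one _ hmul, inv_eq_right_inv hmul⟩
end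
end
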